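/- arXiv:2307.14222 — 2 statements merged into one kernel-verified Lean document; each statement's English description precedes it below -/
import Mathlib

section
/- Let S ∈ Mat_n(ℝ) be an invertible symmetric matrix and A ∈ Mat_n(ℝ) an invertible matrix, and let A also denote the induced ℂ-linear map ℂⁿ → ℂⁿ. If f is holomorphic on an open set U ⊆ ℂⁿ, then on A⁻¹(U) one has Δ_{AᵀSA}(f ∘ A) = (Δ_S f) ∘ A. (In particular, the holomorphic Laplace operator attached to a nondegenerate quadratic form is independent of the choice of basis used to define it.) -/
open Complex Matrix

/-- Second holomorphic partial derivative `∂²f/∂z_i ∂z_j`. -/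
noncomputable def pderiv2 {n : ℕ} (f : (Fin n → ℂ) → ℂ) (i j : Fin n)
    (z : Fin n → ℂ) : ℂ :=
  fderiv ℂ (fun w => fderiv ℂ f w (Pi.single j 1)) z (Pi.single i 1)

/-- The holomorphic Laplace operator attached to an invertible symmetric real matrix `S`:
`Δ_S f = (1/(8π²)) ∑_{i,j} (S⁻¹)_{ij} ∂²f/∂z_i∂z_j`. -/
noncomputable def laplaceOp {n : ℕ} (S : Matrix (Fin n) (Fin n) ℝ)
    (f : (Fin n → ℂ) → ℂ) (z : Fin n → ℂ) : ℂ :=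
  (1 / (8 * (Real.pi : ℂ) ^ 2)) * ∑ i, ∑ j, ((S⁻¹ i j : ℝ) : ℂ) * pderiv2 f i j z

/-- The iterated partial derivative is the second Fréchet derivative on basis vectors. -/
theorem pderiv2_eq_fderiv_fderiv {n : ℕ} {f : (Fin n → ℂ) → ℂ} {z : Fin n → ℂ}
    (hf : AnalyticAt ℂ f z) (i j : Fin n) :
    pderiv2 f i j z = fderiv ℂ (fderiv ℂ f) z (Pi.single i 1) (Pi.single j 1) := by
  unfold pderiv2
  rw [fderiv_clm_apply hf.fderiv.differentiableAt (differentiableAt_const _)]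
  simp

/-- The second Fréchet derivative of a composition with a continuous linear map. -/
theorem AnalyticAt.fderiv_fderiv_comp_clm {E F G : Type*}
    [NormedAddCommGroup E] [NormedSpace ℂ E] [NormedAddCommGroup F] [NormedSpace ℂ F]
    [NormedAddCommGroup G] [NormedSpace ℂ G] [CompleteSpace G] {f : F → G} (L : E →L[ℂ] F) {z : E}
    (hf : AnalyticAt ℂ f (L z)) (u v : E) :
    fderiv ℂ (fderiv ℂ (fun w => f (L w))) z u v
      = fderiv ℂ (fderiv ℂ f) (L z) (L u) (L v) := by
  have hev : fderiv ℂ (fun w => f (L w)) =ᶠ[nhds z] fun w => (fderiv ℂ f (L w)).comp L := by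
    filter_upwards [L.continuous.continuousAt.eventually hf.eventually_analyticAt] with w hw
    exact (hw.differentiableAt.hasFDerivAt.comp w L.hasFDerivAt).fderiv
  have hd : HasFDerivAt (fun w => fderiv ℂ f (L w)) ((fderiv ℂ (fderiv ℂ f) (L z)).comp L) z :=
    hf.fderiv.differentiableAt.hasFDerivAt.comp z L.hasFDerivAt
  rw [hev.fderiv_eq, (hd.clm_comp (hasFDerivAt_const L z)).fderiv]
  simp

/-- Second partial derivatives transform as a bilinear form under a linear substitution. -/
theorem pderiv2_comp_mulVec {n : ℕ} (M : Matrix (Fin n) (Fin n) ℂ) {f : (Fin n → ℂ) → ℂ}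
    {z : Fin n → ℂ} (hf : AnalyticAt ℂ f (M.mulVec z)) (i j : Fin n) :
    pderiv2 (fun w => f (M.mulVec w)) i j z
      = ∑ k, ∑ l, M k i * M l j * pderiv2 f k l (M.mulVec z) := by
  let L : (Fin n → ℂ) →L[ℂ] (Fin n → ℂ) := LinearMap.toContinuousLinearMap M.mulVecLin
  have hcol (i : Fin n) : L (Pi.single i 1) = ∑ k, M k i • Pi.single k (1 : ℂ) := by
    change M.mulVec (Pi.single i 1) = _
    rw [Matrix.mulVec_single_one]
    exact pi_eq_sum_univ' _
  have hfL : AnalyticAt ℂ (fun w => f (L w)) z :=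
    AnalyticAt.comp (g := f) (f := L) hf (L.analyticAt z)
  change pderiv2 (fun w => f (L w)) i j z = _
  rw [pderiv2_eq_fderiv_fderiv hfL, AnalyticAt.fderiv_fderiv_comp_clm L hf, hcol, hcol]
  simp only [pderiv2_eq_fderiv_fderiv hf, map_sum, map_smul, _root_.sum_apply,
    _root_.smul_apply, smul_eq_mul, Finset.mul_sum]
  rw [Finset.sum_comm]
  refine Finset.sum_congr rfl fun k _ => Finset.sum_congr rfl fun l _ => ?_
  rw [mul_left_comm, mul_assoc]
  rfl

theorem Matrix.mul_inv_transpose_mul_mul_mul_transpose {m R : Type*} [Fintype m] [DecidableEq m]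
    [CommRing R] (S A : Matrix m m R) (hA : IsUnit A.det) :
    A * (Aᵀ * S * A)⁻¹ * Aᵀ = S⁻¹ := by
  have hAt : IsUnit Aᵀ.det := by rwa [Matrix.det_transpose]
  rw [Matrix.mul_inv_rev, Matrix.mul_inv_rev, Matrix.mul_nonsing_inv_cancel_left _ _ hA,
    Matrix.nonsing_inv_mul_cancel_right _ _ hAt]

/-- Change of variables for the holomorphic Laplace operator: if `A` is invertible and acts
on `ℂⁿ` via the induced ℂ-linear map, then `Δ_{AᵀSA}(f ∘ A) = (Δ_S f) ∘ A` on `A⁻¹(U)`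
for any `f` holomorphic on an open set `U`. -/
theorem laplaceOp_comp_linear {n : ℕ} (S A : Matrix (Fin n) (Fin n) ℝ)
    (hS : S.IsSymm) (hSinv : IsUnit S.det) (hAinv : IsUnit A.det)
    (U : Set (Fin n → ℂ)) (hU : IsOpen U) (f : (Fin n → ℂ) → ℂ)
    (hf : AnalyticOnNhd ℂ f U) :
    ∀ z : Fin n → ℂ, (A.map (Complex.ofReal)).mulVec z ∈ U →
      laplaceOp (Aᵀ * S * A) (fun w => f ((A.map (Complex.ofReal)).mulVec w)) z
        = laplaceOp S f ((A.map (Complex.ofReal)).mulVec z) := by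
  intro z hz
  unfold laplaceOp
  congr 1
  have hinv (k l : Fin n) : ((S⁻¹ k l : ℝ) : ℂ)
      = ∑ i, ∑ j, (((Aᵀ * S * A)⁻¹ i j : ℝ) : ℂ) * ((A k i : ℂ) * (A l j : ℂ)) := by
    rw [← Matrix.mul_inv_transpose_mul_mul_mul_transpose S A hAinv]
    simp only [Matrix.mul_apply (M := A * _), Matrix.mul_apply (M := A), Matrix.transpose_apply,
      Finset.sum_mul]
    push_cast
    rw [Finset.sum_comm]
    exact Finset.sum_congr rfl fun i _ => Finset.sum_congr rfl fun j _ => by ring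
  simp only [pderiv2_comp_mulVec _ (hf _ hz), Matrix.map_apply, hinv, Finset.mul_sum,
    Finset.sum_mul]
  rw [Finset.sum_comm_cycle]
  refine Finset.sum_congr rfl fun k _ => ?_
  rw [Finset.sum_comm_cycle]
  exact Finset.sum_congr rfl fun l _ => Finset.sum_congr rfl fun i _ =>
    Finset.sum_congr rfl fun j _ => by ring
end

section
/- Let f be analytic on a σ-stable open set U ⊆ ℂⁿ with f ∘ σ = −f on U. Then there exists an analytic function h on U such that f(z) = z_n · h(z) for all z ∈ U (where z_n denotes the last coordinate of z), and moreover h ∘ σ = h on U. In particular, f vanishes along the hyperplane {z_n = 0} and the quotient f/z_n extends holomorphically across it. -/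
open Complex

/-- The involution `σ` of `ℂⁿ⁺¹` negating the last coordinate. -/
noncomputable def sigmaNeg (n : ℕ) (z : Fin (n + 1) → ℂ) : Fin (n + 1) → ℂ :=
  Function.update z (Fin.last n) (-(z (Fin.last n)))

open scoped Topology NNReal ENNReal

section DividedDifference

variable {𝕜 E F : Type*} [NontriviallyNormedField 𝕜] [NormedAddCommGroup E] [NormedSpace 𝕜 E]
  [NormedAddCommGroup F] [NormedSpace 𝕜 F]

/-- The formal power series obtained from `p` by telescoping the difference
`p (y, …, y) - p (P y, …, P y)` and replacing each factor `y - P y` by the vector `e`. -/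
noncomputable def FormalMultilinearSeries.dividedDifference (p : FormalMultilinearSeries 𝕜 E F)
    (P : E →L[𝕜] E) (e : E) : FormalMultilinearSeries 𝕜 E F := fun m =>
  ∑ i : Fin (m + 1), ((p (m + 1)).curryMid i e).compContinuousLinearMap
    (fun j => if j.castSucc < i then ContinuousLinearMap.id 𝕜 E else P)

theorem FormalMultilinearSeries.smul_dividedDifference_apply
    (p : FormalMultilinearSeries 𝕜 E F) (P : E →L[𝕜] E) (e : E) (m : ℕ) (y : E) (c : 𝕜)
    (hy : y - P y = c • e) :
    c • p.dividedDifference P e m (fun _ => y) =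
      p (m + 1) (fun _ => y) - p (m + 1) (fun _ => P y) := by
  have key := (p (m + 1)).toMultilinearMap.map_piecewise_sub_map_piecewise
    (fun _ => y) (fun _ => P y) (fun _ => 0) Finset.univ
  simp only [Finset.piecewise_univ, Finset.mem_univ, if_true,
    ContinuousMultilinearMap.coe_coe] at key
  rw [key, FormalMultilinearSeries.dividedDifference, sum_apply,
    Finset.smul_sum]
  refine Finset.sum_congr rfl fun i _ => ?_
  rw [ContinuousMultilinearMap.compContinuousLinearMap_apply,
    ← _root_.smul_apply, ← map_smul, ← hy,
    ContinuousMultilinearMap.curryMid_apply]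
  congr 1
  refine (Fin.insertNth_eq_iff).2 ⟨by simp, ?_⟩
  funext j
  rcases lt_or_ge j.castSucc i with h | h
  · simp [Fin.removeNth, h, Fin.succAbove_of_castSucc_lt _ _ h]
  · have h' : i < j.succ := Fin.le_castSucc_iff.1 h
    simp [Fin.removeNth, h.not_gt, Fin.succAbove_of_le_castSucc _ _ h, h'.not_gt, h'.ne']

theorem FormalMultilinearSeries.norm_dividedDifference_le
    (p : FormalMultilinearSeries 𝕜 E F) {P : E →L[𝕜] E} (hP : ‖P‖ ≤ 1) (e : E) (m : ℕ) :
    ‖p.dividedDifference P e m‖ ≤ (m + 1) * (‖p (m + 1)‖ * ‖e‖) := by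
  refine (norm_sum_le _ _).trans ?_
  refine (Finset.sum_le_card_nsmul _ _ (‖p (m + 1)‖ * ‖e‖) fun i _ => ?_).trans (by simp)
  refine (ContinuousMultilinearMap.norm_compContinuousLinearMap_le _ _).trans ?_
  refine (mul_le_of_le_one_right (norm_nonneg _) (Finset.prod_le_one (fun _ _ => norm_nonneg _)
    fun j _ => ?_)).trans ?_
  · split_ifs
    exacts [ContinuousLinearMap.norm_id_le, hP]
  · exact (((p (m + 1)).curryMid i).le_opNorm e).trans_eq (by rw [(p (m + 1)).norm_curryMid])

theorem FormalMultilinearSeries.radius_dividedDifference_pos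
    {p : FormalMultilinearSeries 𝕜 E F} (hp : 0 < p.radius) {P : E →L[𝕜] E} (hP : ‖P‖ ≤ 1)
    (e : E) : 0 < (p.dividedDifference P e).radius := by
  obtain ⟨r, hr0, hr⟩ := ENNReal.lt_iff_exists_nnreal_btwn.1 hp
  obtain ⟨C, hC0, hC⟩ := p.norm_mul_pow_le_of_lt_radius hr
  have hr0' : 0 < r := by exact_mod_cast hr0
  have hs : (0 : ℝ≥0∞) < ((r / 2 : ℝ≥0) : ℝ≥0∞) := by
    exact_mod_cast half_pos hr0'
  refine hs.trans_le (FormalMultilinearSeries.le_radius_of_bound _ (C / r * ‖e‖) fun m => ?_)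
  have h2 : ((m : ℝ) + 1) ≤ 2 ^ m := by
    exact_mod_cast Nat.succ_le_of_lt (Nat.lt_two_pow_self (n := m))
  calc ‖p.dividedDifference P e m‖ * ((r / 2 : ℝ≥0) : ℝ) ^ m
      ≤ (m + 1) * (‖p (m + 1)‖ * ‖e‖) * ((r / 2 : ℝ≥0) : ℝ) ^ m := by
        gcongr
        exact p.norm_dividedDifference_le hP e m
    _ ≤ 2 ^ m * (‖p (m + 1)‖ * ‖e‖) * ((r / 2 : ℝ≥0) : ℝ) ^ m := by gcongr
    _ = ‖p (m + 1)‖ * (r : ℝ) ^ (m + 1) / r * ‖e‖ := by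
        push_cast
        rw [div_pow]
        field_simp
        ring
    _ ≤ C / r * ‖e‖ := by gcongr; exact hC _

/-- If `y - P y = φ y • e` for all `y`, with `P` a contraction, then the difference
`f (z + y) - f (z + P y)` of an analytic function is analytically divisible by `φ y`. -/
theorem AnalyticAt.exists_sub_eq_smul [CompleteSpace F] {f : E → F} {z : E}
    (hf : AnalyticAt 𝕜 f z) {P : E →L[𝕜] E} (hP : ‖P‖ ≤ 1) (φ : E → 𝕜) (e : E)
    (h : ∀ y, y - P y = φ y • e) :
    ∃ g : E → F, AnalyticAt 𝕜 g 0 ∧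
      ∀ᶠ y in 𝓝 0, f (z + y) - f (z + P y) = φ y • g y := by
  obtain ⟨p, hp⟩ := hf
  have hq := (p.dividedDifference P e).hasFPowerSeriesOnBall
    (p.radius_dividedDifference_pos hp.radius_pos hP e)
  refine ⟨(p.dividedDifference P e).sum, hq.analyticAt, ?_⟩
  have hsum := hp.eventually_hasSum
  have hPsum : ∀ᶠ y in 𝓝 (0 : E), HasSum (fun n => p n fun _ => P y) (f (z + P y)) :=
    (P.continuous.tendsto' 0 0 (map_zero P)).eventually hsum
  filter_upwards [hsum, hPsum, hq.hasFPowerSeriesAt.eventually_hasSum] with y h₁ h₂ h₃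
  have h₄ := (h₃.const_smul (φ y))
  simp only [p.smul_dividedDifference_apply P e _ y _ (h y), zero_add] at h₄
  have h₅ := (hasSum_nat_add_iff' 1).2 (h₁.sub h₂)
  have h₀ : (p 0 fun _ => y) = p 0 fun _ => P y := congrArg (p 0) (Subsingleton.elim _ _)
  simp only [Finset.range_one, Finset.sum_singleton, h₀, sub_self, sub_zero] at h₅
  exact h₅.unique h₄

end DividedDifference

theorem sigmaNeg_eq_self {n : ℕ} {z : Fin (n + 1) → ℂ} (hz : z (Fin.last n) = 0) :
    sigmaNeg n z = z := by
  simp [sigmaNeg, hz]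

/-- A function analytic near a point of a coordinate hyperplane and vanishing on that hyperplane
is locally the product of the coordinate and an analytic function. -/
theorem AnalyticAt.exists_eventuallyEq_coord_mul {ι : Type*} [Fintype ι] [DecidableEq ι] (k : ι)
    {f : (ι → ℂ) → ℂ} {z : ι → ℂ} (hf : AnalyticAt ℂ f z) (hz : z k = 0)
    (h0 : ∀ᶠ w in 𝓝 z, w k = 0 → f w = 0) :
    ∃ g : (ι → ℂ) → ℂ, AnalyticAt ℂ g z ∧ ∀ᶠ w in 𝓝 z, f w = w k * g w := by
  let P : (ι → ℂ) →L[ℂ] (ι → ℂ) := ContinuousLinearMap.pi fun i =>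
    if i = k then 0 else ContinuousLinearMap.proj i
  have hPk (y) : P y k = 0 := by simp [P]
  have hPi (y) {i} (hi : i ≠ k) : P y i = y i := by simp [P, hi]
  have hP : ‖P‖ ≤ 1 := by
    refine P.opNorm_le_bound zero_le_one fun y => ?_
    rw [one_mul]
    refine (pi_norm_le_iff_of_nonneg (norm_nonneg y)).2 fun i => ?_
    by_cases hi : i = k
    · simp [hi, hPk]
    · rw [hPi y hi]
      exact norm_le_pi_norm y i
  obtain ⟨g, hg, hfg⟩ := hf.exists_sub_eq_smul hP (fun y => y k) (Pi.single k 1) fun y => by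
    funext i
    by_cases hi : i = k
    · subst hi
      simp [hPk]
    · simp [hPi y hi, hi]
  have ht : Filter.Tendsto (fun w => w - z) (𝓝 z) (𝓝 0) :=
    (continuous_id.sub continuous_const).tendsto' _ _ (sub_self z)
  have ht' : Filter.Tendsto (fun w => z + P (w - z)) (𝓝 z) (𝓝 z) := by
    refine Continuous.tendsto' (by fun_prop) _ _ (by simp)
  refine ⟨fun w => g (w - z), ?_, ?_⟩
  · exact AnalyticAt.fun_comp (by rwa [sub_self]) (analyticAt_id.sub analyticAt_const)
  · filter_upwards [ht.eventually hfg, ht'.eventually h0] with w h₁ h₂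
    rw [h₂ (by simp [hPk, hz])] at h₁
    simpa [hz] using h₁

/-- If `f` is analytic on a `σ`-stable open set `U` with `f ∘ σ = -f`, then `f = z_n · h`
for an analytic function `h` on `U` satisfying `h ∘ σ = h`.  In particular `f` vanishes on
the hyperplane `{z_n = 0}` and `f / z_n` extends holomorphically across it. -/
theorem odd_function_factors {n : ℕ}
    (U : Set (Fin (n + 1) → ℂ)) (hU : IsOpen U) (hUσ : sigmaNeg n '' U = U)
    (f : (Fin (n + 1) → ℂ) → ℂ) (hf : AnalyticOnNhd ℂ f U)
    (hodd : ∀ z ∈ U, f (sigmaNeg n z) = -f z) :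
    ∃ h : (Fin (n + 1) → ℂ) → ℂ, AnalyticOnNhd ℂ h U ∧
      (∀ z ∈ U, f z = z (Fin.last n) * h z) ∧
      (∀ z ∈ U, h (sigmaNeg n z) = h z) := by
  have hzero : ∀ z ∈ U, z (Fin.last n) = 0 → f z = 0 := fun z hz hz0 => by
    have := hodd z hz
    rw [sigmaNeg_eq_self hz0] at this
    exact self_eq_neg.1 this
  let h : (Fin (n + 1) → ℂ) → ℂ := fun z =>
    if z (Fin.last n) = 0 then fderiv ℂ f z (Pi.single (Fin.last n) 1)
    else f z / z (Fin.last n)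
  have hmul : ∀ z ∈ U, f z = z (Fin.last n) * h z := fun z hz => by
    by_cases hz0 : z (Fin.last n) = 0
    · rw [hzero z hz hz0, hz0, zero_mul]
    · simp only [h, if_neg hz0]
      field_simp
  refine ⟨h, fun z hz => ?_, hmul, fun z hz => ?_⟩
  · by_cases hz0 : z (Fin.last n) = 0
    · obtain ⟨g, hg, hfg⟩ := (hf z hz).exists_eventuallyEq_coord_mul (Fin.last n) hz0
        (Filter.eventually_of_mem (hU.mem_nhds hz) hzero)
      refine hg.congr ?_
      filter_upwards [hg.eventually_analyticAt, hfg.eventually_nhds] with w hgw hw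
      by_cases hw0 : w (Fin.last n) = 0
      · have hd : HasFDerivAt (fun w : Fin (n + 1) → ℂ => w (Fin.last n) * g w)
            (w (Fin.last n) • fderiv ℂ g w +
              g w • ContinuousLinearMap.proj (R := ℂ) (φ := fun _ => ℂ) (Fin.last n)) w :=
          (hasFDerivAt_apply (Fin.last n) w).mul hgw.differentiableAt.hasFDerivAt
        simp [h, hw0, (hd.congr_of_eventuallyEq hw).fderiv]
      · simp only [h, if_neg hw0, hw.self_of_nhds]
        field_simp
    · have hne : ∀ᶠ w in 𝓝 z, w (Fin.last n) ≠ 0 :=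
        (continuous_apply (Fin.last n)).continuousAt.eventually_ne hz0
      refine ((hf z hz).div ((ContinuousLinearMap.proj (R := ℂ) (φ := fun _ => ℂ)
        (Fin.last n)).analyticAt z) hz0).congr ?_
      filter_upwards [hne] with w hw
      simp [h, hw]
  · by_cases hz0 : z (Fin.last n) = 0
    · rw [sigmaNeg_eq_self hz0]
    · have hs : sigmaNeg n z (Fin.last n) = -z (Fin.last n) := by simp [sigmaNeg]
      simp only [h, hs, neg_eq_zero, if_neg hz0, hodd z hz, neg_div_neg_eq]
end
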